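/- There are infinitely many binary words that are simultaneously extremal, irreducible, and delicate overlap-free; that is, for every N there exists an overlap-free word w over {0,1} of length greater than N that is extremal, irreducible, and delicate. -/

import Mathlib

/-- An overlap is a word of the form xYxYx where x is a letter and Y is a
possibly empty word. -/
def IsOverlap {α : Type*} (w : List α) : Prop :=
  ∃ (x : α) (Y : List α), w = [x] ++ Y ++ [x] ++ Y ++ [x]

/-- A word contains an overlap if some factor (contiguous subword) of it is an overlap. -/
def HasOverlap {α : Type*} (w : List α) : Prop :=
  ∃ u, u <:+: w ∧ IsOverlap u

/-- A word is overlap-free if none of its factors is an overlap. -/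
def OverlapFree {α : Type*} (w : List α) : Prop := ¬ HasOverlap w

/-- An extremal overlap-free binary word: an overlap-free word over {0,1} such that
inserting any letter at any position (including the ends) creates an overlap. -/
def ExtremalOverlapFree (w : List (Fin 2)) : Prop :=
  OverlapFree w ∧
    ∀ u v : List (Fin 2), w = u ++ v → ∀ a : Fin 2, HasOverlap (u ++ a :: v)

/-- An irreducible overlap-free word: an overlap-free word of length at least 3
such that removing any one interior letter creates an overlap. -/
def IrreducibleOverlapFree (w : List (Fin 2)) : Prop :=
  OverlapFree w ∧ 3 ≤ w.length ∧
    ∀ i : ℕ, 0 < i → i + 1 < w.length → HasOverlap (w.eraseIdx i)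

/-- A delicate overlap-free binary word: a nonempty overlap-free word over {0,1}
such that changing any one of its letters to the other letter creates an overlap. -/
def DelicateOverlapFree (w : List (Fin 2)) : Prop :=
  w ≠ [] ∧ OverlapFree w ∧
    ∀ (i : ℕ) (h : i < w.length) (a : Fin 2), a ≠ w.get ⟨i, h⟩ → HasOverlap (w.set i a)

/-- The factor of `w` of length `2p + 1` at position `i` has period `p > 0`, that is, it is an
overlap. -/
def HasOverlapAt {α : Type*} (w : List α) (i p : ℕ) : Prop :=
  0 < p ∧ i + 2 * p < w.length ∧ ∀ j < p + 1, w[i + j]? = w[i + j + p]?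

instance {α : Type*} [DecidableEq α] (w : List α) (i p : ℕ) : Decidable (HasOverlapAt w i p) :=
  inferInstanceAs (Decidable (_ ∧ _ ∧ _))

theorem HasOverlapAt.hasOverlap {α : Type*} {w : List α} {i p : ℕ} (h : HasOverlapAt w i p) :
    HasOverlap w := by
  obtain ⟨hp, hlt, hj⟩ := h
  refine ⟨(w.drop i).take (2 * p + 1),
    (List.take_prefix _ _).isInfix.trans (List.drop_suffix _ _).isInfix,
    w[i], (w.drop (i + 1)).take (p - 1), ?_⟩
  apply List.ext_getElem?
  intro n
  have h0 := hj 0 (by omega)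
  have hlast := hj p (by omega)
  have hw : w[i]? = some w[i] := List.getElem?_eq_getElem (by omega)
  simp only [Nat.add_zero] at h0
  simp only [List.append_assoc, List.singleton_append, List.getElem?_take, List.getElem?_drop,
    List.getElem?_cons, List.getElem?_append, List.length_cons, List.length_take,
    List.length_drop]
  have hmin : min (p - 1) (w.length - (i + 1)) = p - 1 := by omega
  rw [hmin, Nat.sub_add_cancel hp]
  by_cases h1 : n = 0
  · subst h1; simp [hp, hw]
  by_cases h2 : n < p
  · rw [if_pos (by omega), if_pos h2, if_neg h1, if_pos (by omega)]
    congr 1; omega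
  by_cases h3 : n = p
  · subst h3
    rw [if_pos (by omega), if_neg h2, if_pos (by omega), if_pos (by omega), ← h0, hw]
  by_cases h4 : n < 2 * p
  · have := hj (n - p) (by omega)
    rw [if_pos (by omega), if_neg h2, if_pos (by omega), if_neg (by omega), if_pos (by omega),
      show i + 1 + (n - p - 1) = i + (n - p) by omega, this]
    congr 1; omega
  by_cases h5 : n = 2 * p
  · subst h5
    rw [if_pos (by omega), if_neg h2, if_neg (by omega), if_pos (by omega), ← hw, h0, hlast]
    congr 1; omega
  · rw [if_neg (by omega), if_neg h2, if_neg (by omega), if_neg (by omega)]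
    simp

theorem HasOverlap.exists_at {α : Type*} {w : List α} (h : HasOverlap w) :
    ∃ i p, HasOverlapAt w i p := by
  obtain ⟨_, ⟨s, t, rfl⟩, x, Y, rfl⟩ := h
  refine ⟨s.length, Y.length + 1, by omega, by simp; omega, fun j hj => ?_⟩
  simp only [List.append_assoc, List.singleton_append, List.getElem?_append, List.getElem?_cons,
    List.length_cons]
  grind

theorem hasOverlap_iff_exists_lt {α : Type*} {w : List α} :
    HasOverlap w ↔ ∃ i < w.length, ∃ p < w.length, HasOverlapAt w i p := by
  constructor
  · intro h
    obtain ⟨i, p, h⟩ := h.exists_at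
    have := h.1
    have := h.2.1
    exact ⟨i, by omega, p, by omega, h⟩
  · rintro ⟨i, _, p, _, h⟩
    exact h.hasOverlap

instance {α : Type*} [DecidableEq α] (w : List α) : Decidable (HasOverlap w) :=
  decidable_of_iff _ hasOverlap_iff_exists_lt.symm

instance {α : Type*} [DecidableEq α] (w : List α) : Decidable (OverlapFree w) :=
  inferInstanceAs (Decidable (¬ _))

theorem HasOverlap.of_infix {α : Type*} {u w : List α} (hu : HasOverlap u) (h : u <:+: w) :
    HasOverlap w := by
  obtain ⟨s, hs, ho⟩ := hu
  exact ⟨s, hs.trans h, ho⟩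

theorem HasOverlap.append {α : Type*} {s : List α} (h : HasOverlap s) (P Q : List α) :
    HasOverlap (P ++ s ++ Q) :=
  h.of_infix ⟨P, Q, rfl⟩

theorem OverlapFree.of_infix {α : Type*} {u w : List α} (hw : OverlapFree w) (h : u <:+: w) :
    OverlapFree u :=
  fun hu => hw (hu.of_infix h)

/-- The Thue–Morse morphism `0 ↦ 01`, `1 ↦ 10`. -/
def thueMorse (w : List (Fin 2)) : List (Fin 2) := w.flatMap fun a => [a, a + 1]

@[simp] theorem thueMorse_nil : thueMorse [] = [] := rfl

@[simp] theorem thueMorse_cons (a : Fin 2) (w : List (Fin 2)) :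
    thueMorse (a :: w) = a :: (a + 1) :: thueMorse w := rfl

@[simp] theorem thueMorse_append (u v : List (Fin 2)) :
    thueMorse (u ++ v) = thueMorse u ++ thueMorse v := List.flatMap_append

@[simp] theorem length_thueMorse (w : List (Fin 2)) :
    (thueMorse w).length = 2 * w.length := by
  induction w with
  | nil => rfl
  | cons a w ih => simp [ih]; omega

theorem thueMorse_getElem?_even (w : List (Fin 2)) (n : ℕ) :
    (thueMorse w)[2 * n]? = w[n]? := by
  induction w generalizing n with
  | nil => simp
  | cons a w ih =>
    cases n with
    | zero => simp
    | succ n => simpa [Nat.mul_add] using ih n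

theorem thueMorse_getElem?_odd (w : List (Fin 2)) (n : ℕ) :
    (thueMorse w)[2 * n + 1]? = w[n]?.map (· + 1) := by
  induction w generalizing n with
  | nil => simp
  | cons a w ih =>
    cases n with
    | zero => simp
    | succ n => simpa [Nat.mul_add] using ih n

theorem thueMorse_getElem?_ne (w : List (Fin 2)) {n : ℕ} (hn : n < (thueMorse w).length)
    (he : Even n) : (thueMorse w)[n]? ≠ (thueMorse w)[n + 1]? := by
  obtain ⟨m, rfl⟩ := he
  rw [← two_mul, thueMorse_getElem?_even, thueMorse_getElem?_odd]
  rw [length_thueMorse] at hn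
  rw [List.getElem?_eq_getElem (by omega)]
  generalize w[m] = a
  revert a
  decide

/-- In a Thue–Morse image every overlap has even period: an overlap of odd period would be
an alternating word. -/
theorem even_of_hasOverlapAt_thueMorse {w : List (Fin 2)} {i p : ℕ}
    (h : HasOverlapAt (thueMorse w) i p) : Even p := by
  obtain ⟨hp, hlt, hj⟩ := h
  by_contra hodd
  rw [Nat.not_even_iff_odd] at hodd
  set u := thueMorse w with hu
  have hne : ∀ j < p, u[i + j]? ≠ u[i + j + 1]? := by
    intro j hjp
    rcases Nat.even_or_odd (i + j) with he | ho
    · exact thueMorse_getElem?_ne w (by rw [← hu]; omega) he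
    · have h1 := hj j (by omega)
      have h2 := hj (j + 1) (by omega)
      have := thueMorse_getElem?_ne w (n := i + j + p) (by rw [← hu]; omega) (ho.add_odd hodd)
      rw [h1, show i + j + 1 = i + (j + 1) by ring, h2]
      rwa [show i + (j + 1) + p = i + j + p + 1 by ring]
  have halt : ∀ j ≤ p, (u[i + j]? = u[i]? ↔ Even j) := by
    intro j hjp
    induction j with
    | zero => simp
    | succ j ih =>
      have h1 := hne j (by omega)
      have h2 := ih (by omega)
      rw [Nat.even_add_one, ← h2, ← add_assoc]
      rw [List.getElem?_eq_getElem (show i + j < u.length by omega),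
        List.getElem?_eq_getElem (show i + j + 1 < u.length by omega)] at h1
      rw [List.getElem?_eq_getElem (show i < u.length by omega),
        List.getElem?_eq_getElem (show i + j < u.length by omega),
        List.getElem?_eq_getElem (show i + j + 1 < u.length by omega)]
      simp only [ne_eq, Option.some.injEq] at h1 ⊢
      omega
  have h0 := hj 0 (by omega)
  simp only [Nat.add_zero] at h0
  exact (Nat.not_even_iff_odd.2 hodd) ((halt p le_rfl).1 h0.symm)

theorem OverlapFree.thueMorse {w : List (Fin 2)} (hw : OverlapFree w) :
    OverlapFree (thueMorse w) := by
  intro h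
  obtain ⟨i, p, h⟩ := h.exists_at
  obtain ⟨q, rfl⟩ := even_of_hasOverlapAt_thueMorse h
  obtain ⟨hp, hlt, hj⟩ := h
  rw [length_thueMorse] at hlt
  apply hw
  rcases Nat.even_or_odd' i with ⟨m, rfl | rfl⟩
  · refine HasOverlapAt.hasOverlap (i := m) (p := q) ⟨by omega, by omega, fun j hjq => ?_⟩
    have := hj (2 * j) (by omega)
    rwa [show 2 * m + 2 * j + (q + q) = 2 * (m + j + q) by ring, ← mul_add,
      thueMorse_getElem?_even, thueMorse_getElem?_even] at this
  · refine HasOverlapAt.hasOverlap (i := m) (p := q) ⟨by omega, by omega, fun j hjq => ?_⟩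
    have := hj (2 * j) (by omega)
    rw [show 2 * m + 1 + 2 * j + (q + q) = 2 * (m + j + q) + 1 by ring,
      show 2 * m + 1 + 2 * j = 2 * (m + j) + 1 by ring,
      thueMorse_getElem?_odd, thueMorse_getElem?_odd] at this
    exact Option.map_injective (add_left_injective 1) this

/-- Every letter is the last letter of a square prefix of `w`. -/
def SquarePrefixes (w : List (Fin 2)) : Prop :=
  ∀ a, ∃ Y, Y ++ [a] ++ (Y ++ [a]) <+: w

/-- Every letter is the first letter of a square suffix of `w`. -/
def SquareSuffixes (w : List (Fin 2)) : Prop :=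
  ∀ a, ∃ Y, a :: Y ++ (a :: Y) <:+ w

theorem SquarePrefixes.hasOverlap_cons {w : List (Fin 2)} (h : SquarePrefixes w) (a : Fin 2) :
    HasOverlap (a :: w) := by
  obtain ⟨Y, t, rfl⟩ := h a
  exact ⟨a :: Y ++ [a] ++ Y ++ [a], ⟨[], t, by simp⟩, a, Y, by simp⟩

theorem SquareSuffixes.hasOverlap_concat {w : List (Fin 2)} (h : SquareSuffixes w) (a : Fin 2) :
    HasOverlap (w ++ [a]) := by
  obtain ⟨Y, t, rfl⟩ := h a
  exact ⟨a :: Y ++ [a] ++ Y ++ [a], ⟨t, [], by simp⟩, a, Y, by simp⟩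

theorem SquarePrefixes.thueMorse {w : List (Fin 2)} (h : SquarePrefixes w) :
    SquarePrefixes (thueMorse w) := by
  intro a
  obtain ⟨Y, t, rfl⟩ := h (a + 1)
  have ha : ∀ b : Fin 2, b + 1 + 1 = b := by decide
  exact ⟨_root_.thueMorse Y ++ [a + 1], _root_.thueMorse t, by simp [ha]⟩

theorem SquareSuffixes.thueMorse {w : List (Fin 2)} (h : SquareSuffixes w) :
    SquareSuffixes (thueMorse w) := by
  intro a
  obtain ⟨Y, t, rfl⟩ := h a
  exact ⟨(a + 1) :: _root_.thueMorse Y, _root_.thueMorse t, by simp⟩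

set_option synthInstance.maxSize 2048 in
/-- Modifying a letter of `μ²(abc)` near its middle, or near an end at which the preimage starts
or ends with two different letters, creates an overlap. -/
theorem hasOverlap_modify_thueMorse_triple : ∀ a b c : Fin 2, ¬ (a = b ∧ b = c) → ∀ j < 12,
    (j < 4 → a ≠ b) → (8 ≤ j → b ≠ c) →
    (∀ x, (thueMorse (thueMorse [a, b, c]))[j]? ≠ some x →
      HasOverlap ((thueMorse (thueMorse [a, b, c])).set j x)) ∧
    (j ≠ 0 → j ≠ 11 → HasOverlap ((thueMorse (thueMorse [a, b, c])).eraseIdx j)) ∧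
    ∀ x, HasOverlap ((thueMorse (thueMorse [a, b, c])).insertIdx j x) ∨
      (j < 4 ∧ (thueMorse (thueMorse [a, b, c])).insertIdx j x =
        x :: thueMorse (thueMorse [a, b, c])) ∨
      (8 ≤ j ∧ (thueMorse (thueMorse [a, b, c])).insertIdx j x =
        thueMorse (thueMorse [a, b, c]) ++ [x]) := by
  decide +kernel

/-- Every position in `μ³(x)` lies in a factor `μ²(abc)`, in its middle third unless it is close
to an end of the word. -/
theorem exists_thueMorse_triple {x : List (Fin 2)} (hx : OverlapFree x) (hlen : 2 ≤ x.length)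
    {i : ℕ} (hi : i < (thueMorse (thueMorse (thueMorse x))).length) :
    ∃ P a b c Q j, thueMorse (thueMorse (thueMorse x)) =
        P ++ thueMorse (thueMorse [a, b, c]) ++ Q ∧
      i = P.length + j ∧ ¬ (a = b ∧ b = c) ∧ j < 12 ∧
      (j < 4 → P = [] ∧ a ≠ b) ∧ (8 ≤ j → Q = [] ∧ b ≠ c) := by
  have key : ∃ A a b c B k, thueMorse x = A ++ [a, b, c] ++ B ∧ i / 4 = A.length + k ∧ k < 3 ∧
      (k = 0 → A = [] ∧ a ≠ b) ∧ (k = 2 → B = [] ∧ b ≠ c) := by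
    simp only [length_thueMorse] at hi
    by_cases h0 : i / 4 = 0
    · match x, hlen with
      | a :: b :: x, _ =>
        exact ⟨[], a, a + 1, b, (b + 1) :: thueMorse x, 0, by simp, by simpa using h0, by simp,
          by simp, by simp⟩
    by_cases h1 : i / 4 + 1 = 2 * x.length
    · obtain ⟨y, b, rfl⟩ := List.eq_nil_or_concat x |>.resolve_left (by rintro rfl; simp at hlen)
      obtain ⟨z, a, rfl⟩ := List.eq_nil_or_concat y |>.resolve_left (by rintro rfl; simp at hlen)
      refine ⟨thueMorse z ++ [a], a + 1, b, b + 1, [], 2, by simp, ?_, by simp, by simp,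
        by simp⟩
      simp at h1 ⊢
      omega
    · have hl := length_thueMorse x
      refine ⟨(thueMorse x).take (i / 4 - 1), (thueMorse x)[i / 4 - 1], (thueMorse x)[i / 4],
        (thueMorse x)[i / 4 + 1], (thueMorse x).drop (i / 4 + 2), 1, ?_, ?_, by simp, by simp,
        by simp⟩
      · conv_lhs => rw [← List.take_append_drop (i / 4 - 1) (thueMorse x)]
        rw [List.append_assoc, List.drop_eq_getElem_cons (by omega)]
        have : i / 4 - 1 + 1 = i / 4 := by omega
        simp only [this]
        rw [List.drop_eq_getElem_cons (by omega), List.drop_eq_getElem_cons (by omega)]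
        simp
      · simp only [List.length_take]
        omega
  obtain ⟨A, a, b, c, B, k, hv, hik, hk, hk0, hk2⟩ := key
  refine ⟨thueMorse (thueMorse A), a, b, c, thueMorse (thueMorse B), 4 * k + i % 4, ?_, ?_, ?_,
    by omega, fun h => ?_, fun h => ?_⟩
  · rw [hv]; simp only [thueMorse_append]
  · simp only [length_thueMorse]; omega
  · rintro ⟨rfl, rfl⟩
    refine hx.thueMorse (HasOverlap.of_infix ?_ ⟨A, B, hv.symm⟩)
    exact ⟨_, List.infix_rfl, a, [], rfl⟩
  · obtain ⟨rfl, h⟩ := hk0 (by omega)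
    exact ⟨rfl, h⟩
  · obtain ⟨rfl, h⟩ := hk2 (by omega)
    exact ⟨rfl, h⟩

theorem delicateOverlapFree_thueMorse {x : List (Fin 2)} (hx : OverlapFree x)
    (hlen : 2 ≤ x.length) :
    DelicateOverlapFree (thueMorse (thueMorse (thueMorse x))) := by
  refine ⟨fun h => ?_, hx.thueMorse.thueMorse.thueMorse, fun i hi y hy => ?_⟩
  · have := congrArg List.length h
    simp at this
    simp [this] at hlen
  obtain ⟨P, a, b, c, Q, j, hW, rfl, habc, hj, h0, h2⟩ := exists_thueMorse_triple hx hlen hi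
  have hS : (thueMorse (thueMorse [a, b, c])).length = 12 := rfl
  have hne : (thueMorse (thueMorse [a, b, c]))[j]? ≠ some y := by
    intro h
    apply hy
    have : (thueMorse (thueMorse (thueMorse x)))[P.length + j]? = some y := by
      rw [hW, List.append_assoc, List.getElem?_append_right (by omega), Nat.add_sub_cancel_left,
        List.getElem?_append_left (by omega), h]
    rw [List.getElem?_eq_getElem hi] at this
    simpa using this.symm
  have := (hasOverlap_modify_thueMorse_triple a b c habc j hj (fun h => (h0 h).2)
    (fun h => (h2 h).2)).1 y hne
  rw [hW, List.append_assoc, List.set_append_right _ _ (by omega), Nat.add_sub_cancel_left,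
    List.set_append_left _ _ (by omega), ← List.append_assoc]
  exact this.append P Q

theorem irreducibleOverlapFree_thueMorse {x : List (Fin 2)} (hx : OverlapFree x)
    (hlen : 2 ≤ x.length) :
    IrreducibleOverlapFree (thueMorse (thueMorse (thueMorse x))) := by
  refine ⟨hx.thueMorse.thueMorse.thueMorse, by simp; omega, fun i hi0 hi => ?_⟩
  obtain ⟨P, a, b, c, Q, j, hW, rfl, habc, hj, h0, h2⟩ :=
    exists_thueMorse_triple hx hlen (i := i) (by omega)
  have hS : (thueMorse (thueMorse [a, b, c])).length = 12 := rfl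
  have := (hasOverlap_modify_thueMorse_triple a b c habc j hj (fun h => (h0 h).2)
    (fun h => (h2 h).2)).2.1 ?_ ?_
  · rw [hW, List.append_assoc, List.eraseIdx_append_of_length_le (by omega),
      Nat.add_sub_cancel_left, List.eraseIdx_append_of_lt_length (by omega), ← List.append_assoc]
    exact this.append P Q
  · rintro rfl
    simp [(h0 (by omega)).1] at hi0
  · rintro rfl
    rw [hW, (h2 (by omega)).1] at hi
    simp only [List.length_append, hS, List.length_nil] at hi
    omega

theorem List.insertIdx_append_length_add {α : Type*} (P S : List α) (j : ℕ) (x : α) :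
    (P ++ S).insertIdx (P.length + j) x = P ++ S.insertIdx j x := by
  induction P with
  | nil => simp
  | cons p P ih => simpa [Nat.add_right_comm] using ih

theorem List.insertIdx_append_of_le_length {α : Type*} {S : List α} (Q : List α) {j : ℕ} (x : α)
    (hj : j ≤ S.length) : (S ++ Q).insertIdx j x = S.insertIdx j x ++ Q := by
  induction S generalizing j with
  | nil => simp_all
  | cons s S ih =>
    cases j with
    | zero => simp
    | succ j => simpa using ih (by simpa using hj)

theorem extremalOverlapFree_thueMorse {x : List (Fin 2)} (hx : OverlapFree x)
    (hlen : 2 ≤ x.length) (hpre : SquarePrefixes x) (hsuf : SquareSuffixes x) :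
    ExtremalOverlapFree (thueMorse (thueMorse (thueMorse x))) := by
  refine ⟨hx.thueMorse.thueMorse.thueMorse, fun u v huv y => ?_⟩
  rcases v with _ | ⟨z, v⟩
  · rw [List.append_nil] at huv
    rw [← huv]
    exact hsuf.thueMorse.thueMorse.thueMorse.hasOverlap_concat y
  have hins : u ++ y :: z :: v =
      (thueMorse (thueMorse (thueMorse x))).insertIdx u.length y := by
    rw [huv, ← Nat.add_zero u.length, List.insertIdx_append_length_add]
    rfl
  obtain ⟨P, a, b, c, Q, j, hW, hij, habc, hj, h0, h2⟩ :=
    exists_thueMorse_triple hx hlen (i := u.length) (by rw [huv]; simp)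
  have hS : (thueMorse (thueMorse [a, b, c])).length = 12 := rfl
  rw [hins, hij, hW, List.append_assoc, List.insertIdx_append_length_add,
    List.insertIdx_append_of_le_length Q y (by omega), ← List.append_assoc]
  rcases (hasOverlap_modify_thueMorse_triple a b c habc j hj (fun h => (h0 h).2)
    (fun h => (h2 h).2)).2.2 y with h | ⟨hj', h⟩ | ⟨hj', h⟩
  · exact h.append P Q
  · have := hpre.thueMorse.thueMorse.thueMorse.hasOverlap_cons y
    rw [hW] at this
    rw [h]
    simpa [(h0 hj').1] using this
  · have := hsuf.thueMorse.thueMorse.thueMorse.hasOverlap_concat y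
    rw [hW] at this
    rw [h]
    simpa [(h2 hj').1] using this

theorem exists_overlapFree_squarePrefixes_squareSuffixes (N : ℕ) :
    ∃ x, N + 2 ≤ x.length ∧ OverlapFree x ∧ SquarePrefixes x ∧ SquareSuffixes x := by
  induction N with
  | zero =>
    refine ⟨[0, 0, 1, 1, 0, 0, 1, 1], by simp, by decide +kernel, fun a => ?_, fun a => ?_⟩
    · fin_cases a
      · exact ⟨[], by decide⟩
      · exact ⟨[0, 0, 1], by decide⟩
    · fin_cases a
      · exact ⟨[0, 1, 1], by decide⟩
      · exact ⟨[], by decide⟩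
  | succ N ih =>
    obtain ⟨x, hlen, hx, hpre, hsuf⟩ := ih
    exact ⟨thueMorse x, by simp; omega, hx.thueMorse, hpre.thueMorse, hsuf.thueMorse⟩

theorem infinitely_many_extremal_irreducible_delicate_overlapFree (N : ℕ) :
    ∃ w : List (Fin 2), N < w.length ∧ OverlapFree w ∧
      ExtremalOverlapFree w ∧ IrreducibleOverlapFree w ∧ DelicateOverlapFree w := by
  obtain ⟨x, hlen, hx, hpre, hsuf⟩ := exists_overlapFree_squarePrefixes_squareSuffixes N
  have hlen' : 2 ≤ x.length := by omega
  exact ⟨thueMorse (thueMorse (thueMorse x)), by simp; omega, hx.thueMorse.thueMorse.thueMorse,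
    extremalOverlapFree_thueMorse hx hlen' hpre hsuf, irreducibleOverlapFree_thueMorse hx hlen',
    delicateOverlapFree_thueMorse hx hlen'⟩
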